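/- Let d be an odd prime, L ⊆ (Z/d)^{2n} a Lagrangian subspace (maximal isotropic, of dimension n), and g : L → Z/d a linear functional. Then Π_L^g := d^{-n} Σ_{b ∈ L} ω^{g(b)} T(b) is a rank-one orthogonal projection. -/

import Mathlib

open Matrix

/-- The phase space `(ℤ/d)^{2n}` as pairs `(a_X, a_Z)`. -/
abbrev PS (d n : ℕ) := (Fin n → ZMod d) × (Fin n → ZMod d)

/-- `ω = exp(2πi/d)`. -/
noncomputable def omegaC (d : ℕ) : ℂ := Complex.exp (2 * Real.pi * Complex.I / d)

/-- `ω^k` for an exponent `k : ℤ/d`. -/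
noncomputable def chi (d : ℕ) (k : ZMod d) : ℂ := omegaC d ^ k.val

/-- Dot product over `ℤ/d`. -/
def dotZ {d n : ℕ} (x y : Fin n → ZMod d) : ZMod d := ∑ i, x i * y i

/-- The standard symplectic form `[a,b] = a_X·b_Z − b_X·a_Z`. -/
def symp {d n : ℕ} (a b : PS d n) : ZMod d := dotZ a.1 b.2 - dotZ b.1 a.2

/-- The Weyl-Heisenberg operator `T(a) = τ^{-a_X·a_Z} ⨂ᵢ Z^{(a_Z)_i} X^{(a_X)_i}`,
where `τ = ω^{(d+1)/2} = ω^{2⁻¹ mod d}` for odd `d`. -/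
noncomputable def WH (d n : ℕ) (a : PS d n) :
    Matrix (Fin n → ZMod d) (Fin n → ZMod d) ℂ :=
  Matrix.of fun q q' =>
    if q = q' + a.1 then chi d ((2⁻¹ : ZMod d) * (-(dotZ a.1 a.2)) + dotZ a.2 q) else 0

/-- An isotropic subspace of dimension `n`, i.e. a Lagrangian subspace. -/
def IsLagrangian (d n : ℕ) (L : Submodule (ZMod d) (PS d n)) : Prop :=
  (∀ a ∈ L, ∀ b ∈ L, symp a b = 0) ∧ Module.finrank (ZMod d) L = n

/-- The stabilizer projection `Π_L^g = d^{-n} Σ_{b∈L} ω^{g(b)} T(b)`. -/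
noncomputable def stabProj (d n : ℕ) [Fact d.Prime]
    (L : Submodule (ZMod d) (PS d n)) (g : L →ₗ[ZMod d] ZMod d) :
    Matrix (Fin n → ZMod d) (Fin n → ZMod d) ℂ :=
  letI : Fintype L := Fintype.ofFinite L
  ((d : ℂ) ^ n)⁻¹ • ∑ b : L, chi d (g b) • WH d n (b : PS d n)

theorem chi_eq_std (d : ℕ) [NeZero d] (k : ZMod d) : chi d k = ZMod.stdAddChar k := by
  have h := ZMod.stdAddChar_coe (N := d) (k.val : ℤ)
  have h2 : (((k.val : ℤ)) : ZMod d) = k := by simp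
  rw [h2] at h
  rw [h, chi, omegaC, ← Complex.exp_nat_mul]
  congr 1
  push_cast
  ring

theorem chi_add' (d : ℕ) [NeZero d] (j k : ZMod d) : chi d (j + k) = chi d j * chi d k := by
  simp only [chi_eq_std, AddChar.map_add_eq_mul]

theorem chi_zero' (d : ℕ) [NeZero d] : chi d 0 = 1 := by
  simp only [chi_eq_std, AddChar.map_zero_eq_one]

theorem chi_star' (d : ℕ) [NeZero d] (k : ZMod d) : star (chi d k) = chi d (-k) := by
  simp only [chi_eq_std, ZMod.stdAddChar_apply, AddChar.map_neg_eq_inv]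
  rw [← Circle.coe_inv, Circle.coe_inv_eq_conj]
  rfl

theorem chi_one_ne (d : ℕ) [NeZero d] (k : ZMod d) (hk : k ≠ 0) : chi d k ≠ 1 := by
  rw [chi_eq_std]
  intro h
  apply hk
  apply ZMod.injective_stdAddChar
  rw [h, AddChar.map_zero_eq_one]

section dot
variable {d n : ℕ}
theorem dotZ_add_left (x y z : Fin n → ZMod d) : dotZ (x + y) z = dotZ x z + dotZ y z := by
  simp [dotZ, add_mul, Finset.sum_add_distrib]
theorem dotZ_add_right (x y z : Fin n → ZMod d) : dotZ x (y + z) = dotZ x y + dotZ x z := by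
  simp [dotZ, mul_add, Finset.sum_add_distrib]
theorem dotZ_neg_left (x y : Fin n → ZMod d) : dotZ (-x) y = - dotZ x y := by
  simp [dotZ]
theorem dotZ_neg_right (x y : Fin n → ZMod d) : dotZ x (-y) = - dotZ x y := by
  simp [dotZ]
theorem dotZ_comm (x y : Fin n → ZMod d) : dotZ x y = dotZ y x := by
  simp [dotZ, mul_comm]
end dot

theorem two_inv (d : ℕ) [Fact d.Prime] (hodd : Odd d) : (2 : ZMod d) * 2⁻¹ = 1 := by
  apply mul_inv_cancel₀
  intro h
  have h2 : ((2 : ℕ) : ZMod d) = 0 := by exact_mod_cast h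
  rw [ZMod.natCast_eq_zero_iff] at h2
  have := (Nat.prime_dvd_prime_iff_eq Fact.out Nat.prime_two).1 h2
  subst this
  revert hodd
  decide

theorem WH_mul (d n : ℕ) [Fact d.Prime] (hodd : Odd d) (a b : PS d n) (h : symp a b = 0) :
    WH d n a * WH d n b = WH d n (a + b) := by
  ext q q'
  rw [Matrix.mul_apply, Finset.sum_eq_single (q' + b.1)]
  · simp only [WH, Matrix.of_apply, Prod.fst_add, Prod.snd_add, if_true]
    have e : q' + b.1 + a.1 = q' + (a.1 + b.1) := by abel
    rw [e]
    split_ifs with hq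
    · rw [← chi_add']
      congr 1
      subst hq
      simp only [dotZ_add_left, dotZ_add_right]
      have h2 := two_inv d hodd
      simp only [symp] at h
      rw [dotZ_comm b.2 a.1, dotZ_comm a.2 b.1]
      rw [dotZ_comm b.1 b.2, dotZ_comm a.1 a.2]
      linear_combination (2⁻¹ : ZMod d) * (-1) * h + (dotZ a.1 b.2) * h2
    · simp
  · intro x _ hx
    simp [WH, hx]
  · simp

theorem WH_star (d n : ℕ) [Fact d.Prime] (hodd : Odd d) (a : PS d n) :
    (WH d n a)ᴴ = WH d n (-a) := by
  ext q q'
  rw [Matrix.conjTranspose_apply]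
  simp only [WH, Matrix.of_apply, Prod.fst_neg, Prod.snd_neg]
  by_cases hq : q' = q + a.1
  · have hq2 : q = q' + -a.1 := by rw [hq]; abel
    rw [if_pos hq, if_pos hq2, chi_star', hq]
    congr 1
    have h2 := two_inv d hodd
    simp only [dotZ_add_left, dotZ_add_right, dotZ_neg_left, dotZ_neg_right]
    rw [dotZ_comm a.2 a.1]
    linear_combination (dotZ a.1 a.2) * h2
  · have hq2 : ¬ q = q' + -a.1 := by
      intro h; apply hq; rw [h]; abel
    rw [if_neg hq, if_neg hq2, star_zero]

theorem WH_zero (d n : ℕ) [Fact d.Prime] : WH d n 0 = 1 := by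
  ext q q'
  simp [WH, Matrix.one_apply, dotZ, chi_zero']

theorem WH_trace (d n : ℕ) [Fact d.Prime] (a : PS d n) (ha : a ≠ 0) :
    (WH d n a).trace = 0 := by
  simp only [Matrix.trace, Matrix.diag_apply, WH, Matrix.of_apply]
  by_cases h1 : a.1 = 0
  · have h2 : a.2 ≠ 0 := fun h2 => ha (Prod.ext h1 h2)
    obtain ⟨i, hi⟩ := Function.ne_iff.1 h2
    simp only [h1, add_zero, if_true]
    set f : (Fin n → ZMod d) → ℂ :=
      fun q => chi d ((2⁻¹ : ZMod d) * (-(dotZ 0 a.2)) + dotZ a.2 q) with hf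
    have hs : ∑ q, f q = chi d (a.2 i) * ∑ q, f q := by
      conv_lhs => rw [← Equiv.sum_comp (Equiv.addRight (Pi.single i (1 : ZMod d)))]
      rw [Finset.mul_sum]
      refine Finset.sum_congr rfl fun q _ => ?_
      simp only [hf, Equiv.coe_addRight, dotZ_add_right]
      rw [← chi_add']
      congr 1
      have : dotZ a.2 (Pi.single i (1 : ZMod d)) = a.2 i := by
        simp [dotZ, Pi.single_apply]
      rw [this]; ring
    have h3 : (chi d (a.2 i) - 1) * ∑ q, f q = 0 := by
      rw [sub_mul, ← hs]; ring
    rcases mul_eq_zero.1 h3 with h | h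
    · exact absurd (sub_eq_zero.1 h) (chi_one_ne d _ hi)
    · exact h
  · simp [h1]

theorem rank_of_idem {m : Type*} [Fintype m] [DecidableEq m] (P : Matrix m m ℂ)
    (h : P * P = P) : P.trace = P.rank := by
  have hp : IsIdempotentElem (Matrix.toLin' P) := by
    rw [IsIdempotentElem, Module.End.mul_eq_comp, ← Matrix.toLin'_mul, h]
  have := (LinearMap.IsIdempotentElem.isProj_range _ hp).trace
  rw [Matrix.trace_toLin'_eq] at this
  rw [this, Matrix.rank, Matrix.toLin'_apply']

/-- `Π_L^g` is a rank-one orthogonal projection. -/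
theorem stabProj_is_rank_one_projection (d n : ℕ) [Fact d.Prime] (hodd : Odd d)
    (L : Submodule (ZMod d) (PS d n)) (hL : IsLagrangian d n L)
    (g : L →ₗ[ZMod d] ZMod d) :
    stabProj d n L g * stabProj d n L g = stabProj d n L g ∧
    (stabProj d n L g)ᴴ = stabProj d n L g ∧
    (stabProj d n L g).rank = 1 := by
  obtain ⟨hiso, hdim⟩ := hL
  letI : Fintype L := Fintype.ofFinite L
  have hd : ((d : ℂ) ^ n) ≠ 0 :=
    pow_ne_zero _ (Nat.cast_ne_zero.2 (Fact.out : d.Prime).ne_zero)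
  have hP : stabProj d n L g
      = ((d : ℂ) ^ n)⁻¹ • ∑ b : L, chi d (g b) • WH d n (b : PS d n) := rfl
  have hcard : (Fintype.card L : ℂ) = (d : ℂ) ^ n := by
    rw [Module.card_eq_pow_finrank (K := ZMod d) (V := L), hdim, ZMod.card]
    push_cast
    rfl
  have hidem : stabProj d n L g * stabProj d n L g = stabProj d n L g := by
    rw [hP, Matrix.smul_mul, Matrix.mul_smul]
    congr 1
    rw [Finset.sum_mul]
    have hterm : ∀ a : L, (chi d (g a) • WH d n (a : PS d n)) *
        (∑ b : L, chi d (g b) • WH d n (b : PS d n))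
        = ∑ b : L, chi d (g b) • WH d n (b : PS d n) := by
      intro a
      rw [Finset.mul_sum, ← Equiv.sum_comp (Equiv.addLeft a)
        (fun b : L => chi d (g b) • WH d n (b : PS d n))]
      refine Finset.sum_congr rfl fun b _ => ?_
      rw [Matrix.smul_mul, Matrix.mul_smul, smul_smul, WH_mul d n hodd _ _
        (hiso a a.2 b b.2), ← chi_add', ← map_add]
      rfl
    rw [Finset.sum_congr rfl fun a _ => hterm a, Finset.sum_const, Finset.card_univ,
      ← Nat.cast_smul_eq_nsmul ℂ, hcard, smul_smul, inv_mul_cancel₀ hd, one_smul]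
  refine ⟨hidem, ?_, ?_⟩
  · rw [hP, Matrix.conjTranspose_smul, Matrix.conjTranspose_sum]
    congr 1
    · simp
    · rw [← Equiv.sum_comp (Equiv.neg L)
        (fun b : L => chi d (g b) • WH d n (b : PS d n))]
      refine Finset.sum_congr rfl fun b _ => ?_
      rw [Matrix.conjTranspose_smul, WH_star d n hodd, chi_star', ← map_neg]
      rfl
  · have htr : (stabProj d n L g).trace = 1 := by
      rw [hP, Matrix.trace_smul, Matrix.trace_sum, Finset.sum_eq_single (0 : L)]
      · rw [map_zero, chi_zero', one_smul, Submodule.coe_zero, WH_zero, Matrix.trace_one]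
        simp only [Fintype.card_pi, ZMod.card, Finset.prod_const, Finset.card_univ,
          Fintype.card_fin]
        push_cast
        exact inv_mul_cancel₀ hd
      · intro b _ hb
        rw [Matrix.trace_smul, WH_trace d n _ (by simpa using hb), smul_zero]
      · simp
    rw [rank_of_idem _ hidem] at htr
    exact_mod_cast htr
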